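/- Let A ∈ ℕ^ℕ and let P be a Π^{0,A'}_1 subset of ℕ^ℕ. Then there exist a Π^{0,A}_1 set Q ⊆ ℕ^ℕ and a homeomorphism F: P → Q such that X ⊕ A ≡_T F(X) ⊕ A uniformly for all X ∈ P. -/

import Mathlib

namespace Harrington

open scoped Classical

/-- Codes for oracle Turing machines (partial recursive functionals),
    extending `Nat.Partrec.Code` with an `oracle` constructor. -/
inductive OCode : Type
  | zero : OCode
  | succ : OCode
  | left : OCode
  | right : OCode
  | oracle : OCode
  | pair : OCode → OCode → OCode
  | comp : OCode → OCode → OCode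
  | prec : OCode → OCode → OCode
  | rfind' : OCode → OCode

/-- Evaluation of an oracle code relative to a (total) oracle `A`. -/
def evalo (A : ℕ → ℕ) : OCode → ℕ →. ℕ
  | OCode.zero => pure 0
  | OCode.succ => fun n => Part.some (n + 1)
  | OCode.left => fun n => Part.some (Nat.unpair n).1
  | OCode.right => fun n => Part.some (Nat.unpair n).2
  | OCode.oracle => fun n => Part.some (A n)
  | OCode.pair cf cg => fun n => Nat.pair <$> evalo A cf n <*> evalo A cg n
  | OCode.comp cf cg => fun n => evalo A cg n >>= evalo A cf
  | OCode.prec cf cg =>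
    Nat.unpaired fun a n =>
      n.rec (evalo A cf a) fun y IH => do
        let i ← IH
        evalo A cg (Nat.pair a (Nat.pair y i))
  | OCode.rfind' cf =>
    Nat.unpaired fun a m =>
      (Nat.rfind fun n => (fun x => x = 0) <$> evalo A cf (Nat.pair a (n + m))).map (· + m)

/-- The standard enumeration of oracle codes: `OCode.ofNat e` is the `e`-th oracle machine. -/
def OCode.ofNat : ℕ → OCode
  | 0 => OCode.zero
  | 1 => OCode.succ
  | 2 => OCode.left
  | 3 => OCode.right
  | 4 => OCode.oracle
  | n + 5 =>
    have hm : n.div2.div2 < n + 5 := by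
      have h1 : n.div2.div2 ≤ n := by
        simp only [Nat.div2_val]
        exact le_trans (Nat.div_le_self _ _) (Nat.div_le_self _ _)
      omega
    have _m1 : n.div2.div2.unpair.1 < n + 5 := lt_of_le_of_lt (Nat.unpair_left_le _) hm
    have _m2 : n.div2.div2.unpair.2 < n + 5 := lt_of_le_of_lt (Nat.unpair_right_le _) hm
    match n.bodd, n.div2.bodd with
    | false, false => OCode.pair (OCode.ofNat n.div2.div2.unpair.1) (OCode.ofNat n.div2.div2.unpair.2)
    | false, true  => OCode.comp (OCode.ofNat n.div2.div2.unpair.1) (OCode.ofNat n.div2.div2.unpair.2)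
    | true,  false => OCode.prec (OCode.ofNat n.div2.div2.unpair.1) (OCode.ofNat n.div2.div2.unpair.2)
    | true,  true  => OCode.rfind' (OCode.ofNat n.div2.div2)

/-- The Turing jump `A'` of an oracle `A`:  `A'(e) = 1` if the `e`-th machine with
    oracle `A` halts on input `e`, and `A'(e) = 0` otherwise. -/
noncomputable def jump (A : ℕ → ℕ) : ℕ → ℕ :=
  fun e => if (evalo A (OCode.ofNat e) e).Dom then 1 else 0

/-- Iterated Turing jump `A^{(n)}`. -/
noncomputable def jumpIter (A : ℕ → ℕ) : ℕ → (ℕ → ℕ)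
  | 0 => A
  | n + 1 => jump (jumpIter A n)

/-- The constant zero function (the trivial oracle `0`). -/
def zeroF : ℕ → ℕ := fun _ => 0

/-- The `ω`-jump: `X^{(ω)} = {(i,n) : i ∈ X^{(n)}}`, coded via `Nat.pair` and identified
    with its characteristic function. -/
noncomputable def omegaJump (A : ℕ → ℕ) : ℕ → ℕ :=
  fun m => if jumpIter A m.unpair.2 m.unpair.1 ≠ 0 then 1 else 0

/-- The recursive join `A ⊕ B`. -/
def oplus (A B : ℕ → ℕ) : ℕ → ℕ :=
  fun n => if n % 2 = 0 then A (n / 2) else B (n / 2)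

/-- Code `c` computes the total function `f` from oracle `A`. -/
def computesFn (A : ℕ → ℕ) (c : OCode) (f : ℕ → ℕ) : Prop :=
  ∀ n, evalo A c n = Part.some (f n)

/-- Turing reducibility `X ≤_T A` for points of Baire space. -/
def TRedIn (X A : ℕ → ℕ) : Prop := ∃ c : OCode, computesFn A c X

/-- `X` is arithmetical relative to `Y`: `X ≤_T Y^{(n)}` for some `n`. -/
def ArithIn (X Y : ℕ → ℕ) : Prop := ∃ n : ℕ, TRedIn X (jumpIter Y n)

/-- `X` and `Y` are arithmetically equivalent. -/
def ArithEquiv (X Y : ℕ → ℕ) : Prop := ArithIn X Y ∧ ArithIn Y X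

/-! ### Strings and trees -/

/-- Strings: finite sequences of natural numbers. -/
abbrev Str := List ℕ

/-- The initial segment `X↾n` of a point `X` of Baire space. -/
def initSeg (X : ℕ → ℕ) (n : ℕ) : Str := (List.range n).map X

/-- A tree is a set of strings closed under initial segments. -/
def IsTree (T : Set Str) : Prop := ∀ σ τ : Str, σ <+: τ → τ ∈ T → σ ∈ T

/-- `[T]`, the set of paths through `T`. -/
def paths (T : Set Str) : Set (ℕ → ℕ) := {X | ∀ n, initSeg X n ∈ T}

/-- The characteristic function of a set of strings. -/
noncomputable def chi (T : Set Str) : Str → ℕ := fun σ => if σ ∈ T then 1 else 0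

/-- A set of strings is `A`-recursive: its characteristic function is computable from `A`. -/
def SetRecIn (A : ℕ → ℕ) (T : Set Str) : Prop :=
  ∃ c : OCode, ∀ σ : Str, evalo A c (Encodable.encode σ) = Part.some (chi T σ)

/-- `P ⊆ ℕ^ℕ` is `Π^{0,A}_1` : `P = [T]` for some `A`-recursive tree `T`. -/
def IsPi01In (A : ℕ → ℕ) (P : Set (ℕ → ℕ)) : Prop :=
  ∃ T : Set Str, IsTree T ∧ SetRecIn A T ∧ P = paths T

/-- `P ⊆ ℕ^ℕ` is `Π⁰₁` : `P = [T]` for some recursive tree `T`. -/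
def IsPi01 (P : Set (ℕ → ℕ)) : Prop := IsPi01In zeroF P

/-! ### Treemaps -/

/-- `F` is a treemap on the tree `T`: `F(σ⌢⟨i⟩) ⊇ F(σ)⌢⟨i⟩` whenever `σ⌢⟨i⟩ ∈ T`. -/
def IsTreemapOn (T : Set Str) (F : Str → Str) : Prop :=
  ∀ (σ : Str) (i : ℕ), σ ++ [i] ∈ T → (F σ) ++ [i] <+: F (σ ++ [i])

/-- The image tree `F(T) = {τ : ∃ σ ∈ T, τ ⊆ F(σ)}`. -/
def treeImage (F : Str → Str) (T : Set Str) : Set Str :=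
  {τ | ∃ σ ∈ T, τ <+: F σ}

/-- The map on paths induced by a treemap: `X ↦ ⋃ₙ F(X↾n)`. -/
def pathMap (F : Str → Str) (X : ℕ → ℕ) : ℕ → ℕ :=
  fun i => (F (initSeg X (i + 1))).getD i 0

/-- The string function `F` is `A`-recursive on `T` (restriction of a partial
    `A`-recursive function). -/
def FnRecInOn (A : ℕ → ℕ) (F : Str → Str) (T : Set Str) : Prop :=
  ∃ c : OCode, ∀ σ ∈ T, evalo A c (Encodable.encode σ) = Part.some (Encodable.encode (F σ))

/-- `F` maps `P` homeomorphically onto `Q` (subspace topologies from Baire space). -/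
def HomeoOn (F : (ℕ → ℕ) → (ℕ → ℕ)) (P Q : Set (ℕ → ℕ)) : Prop :=
  Set.BijOn F P Q ∧ ContinuousOn F P ∧
    ∃ G : (ℕ → ℕ) → (ℕ → ℕ), Set.InvOn G F P Q ∧ ContinuousOn G Q

/-- `f X ≡_T g X` uniformly for all `X ∈ P`: the Turing reductions are given by
    fixed indices independent of `X`. -/
def UnifEquivOn (P : Set (ℕ → ℕ)) (f g : (ℕ → ℕ) → (ℕ → ℕ)) : Prop :=
  ∃ c d : OCode, ∀ X ∈ P, computesFn (g X) c (f X) ∧ computesFn (f X) d (g X)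

/-! ### Standard enumerations -/

/-- `W_e^A`: the `e`-th `A`-recursively enumerable set of strings. -/
def WA (A : ℕ → ℕ) (e : ℕ) : Set Str :=
  {σ | (evalo A (OCode.ofNat e) (Encodable.encode σ)).Dom}

/-- `T_e^A = {σ : ∀ n ≤ |σ|, σ↾n ∉ W_e^A}`: the standard enumeration of `Π^{0,A}_1` trees. -/
def TA (A : ℕ → ℕ) (e : ℕ) : Set Str :=
  {σ | ∀ n ≤ σ.length, σ.take n ∉ WA A e}

/-- `P_e^A = [T_e^A]`: the standard enumeration of `Π^{0,A}_1` subsets of Baire space. -/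
def PA (A : ℕ → ℕ) (e : ℕ) : Set (ℕ → ℕ) := paths (TA A e)

/-! ### The arithmetical hierarchy on Baire space -/

/-- Prepend a number to a point of Baire space. -/
def consF (k : ℕ) (X : ℕ → ℕ) : ℕ → ℕ := fun i => Nat.casesOn i k fun j => X j

/-- `Σ⁰ₙ` subsets of Baire space.  `Σ⁰₀` sets are the recursive clopen sets
    (depending computably on a fixed finite initial segment), and
    `Σ⁰ₙ₊₁` sets are obtained from `Π⁰ₙ` sets by existential number quantification. -/
def SigmaN : ℕ → Set (ℕ → ℕ) → Prop
  | 0, P => ∃ (k : ℕ) (f : Str → Bool), Computable f ∧ P = {X | f (initSeg X k) = true}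
  | n + 1, P => ∃ Q : Set (ℕ → ℕ), SigmaN n Qᶜ ∧ P = {X | ∃ k : ℕ, consF k X ∈ Q}

/-- `Π⁰ₙ` subsets of Baire space: complements of `Σ⁰ₙ` sets. -/
def PiN (n : ℕ) (P : Set (ℕ → ℕ)) : Prop := SigmaN n Pᶜ

/-- Arithmetical subsets of Baire space: `Π⁰ₙ` for some `n`. -/
def IsArith (P : Set (ℕ → ℕ)) : Prop := ∃ n : ℕ, PiN n P


open Nat.Partrec (Code)
open Filter Topology

/-! ### Oracle codes -/

/-- Evaluation of an oracle code relative to a partial oracle. -/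
def evalp (O : ℕ →. ℕ) : OCode → ℕ →. ℕ
  | OCode.zero => pure 0
  | OCode.succ => fun n => Part.some (n + 1)
  | OCode.left => fun n => Part.some (Nat.unpair n).1
  | OCode.right => fun n => Part.some (Nat.unpair n).2
  | OCode.oracle => O
  | OCode.pair cf cg => fun n => Nat.pair <$> evalp O cf n <*> evalp O cg n
  | OCode.comp cf cg => fun n => evalp O cg n >>= evalp O cf
  | OCode.prec cf cg =>
    Nat.unpaired fun a n =>
      n.rec (evalp O cf a) fun y IH => do
        let i ← IH
        evalp O cg (Nat.pair a (Nat.pair y i))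
  | OCode.rfind' cf =>
    Nat.unpaired fun a m =>
      (Nat.rfind fun n => (fun x => x = 0) <$> evalp O cf (Nat.pair a (n + m))).map (· + m)

theorem evalp_total (A : ℕ → ℕ) (c : OCode) : evalp (fun n => Part.some (A n)) c = evalo A c := by
  induction c <;> simp [evalp, evalo, *] <;> rfl

/-- Evaluation is continuous in the oracle. -/
theorem eventually_mem_evalp {ι : Type*} {l : Filter ι} {O : ℕ →. ℕ} {Os : ι → ℕ →. ℕ}
    (h : ∀ i v, v ∈ O i → ∀ᶠ k in l, v ∈ Os k i) (c : OCode) :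
    ∀ n v, v ∈ evalp O c n → ∀ᶠ k in l, v ∈ evalp (Os k) c n := by
  induction c with
  | zero | succ | left | right => exact fun n v hv => Eventually.of_forall fun _ => hv
  | oracle => exact h
  | pair cf cg ihf ihg =>
    intro n v hv
    simp only [evalp, Seq.seq, Part.map_eq_map, Part.bind_map, Part.mem_bind_iff,
      Part.mem_map_iff] at hv ⊢
    obtain ⟨a, ha, b, hb, rfl⟩ := hv
    filter_upwards [ihf _ _ ha, ihg _ _ hb] with k h1 h2
    exact ⟨a, h1, b, h2, rfl⟩
  | comp cf cg ihf ihg =>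
    intro n v hv
    obtain ⟨a, ha, hb⟩ := Part.mem_bind_iff.1 hv
    filter_upwards [ihg _ _ ha, ihf _ _ hb] with k h1 h2
    exact Part.mem_bind_iff.2 ⟨a, h1, h2⟩
  | prec cf cg ihf ihg =>
    intro n v hv
    simp only [evalp, Nat.unpaired] at hv ⊢
    generalize n.unpair.1 = a at *
    generalize n.unpair.2 = m at *
    induction m generalizing v with
    | zero => exact ihf _ _ hv
    | succ m ih =>
      obtain ⟨b, hb, hv⟩ := Part.mem_bind_iff.1 hv
      filter_upwards [ih _ hb, ihg _ _ hv] with k h1 h2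
      exact Part.mem_bind_iff.2 ⟨b, h1, h2⟩
  | rfind' cf ih =>
    intro n v hv
    obtain ⟨a, ha, rfl⟩ := (Part.mem_map_iff _).1 hv
    obtain ⟨ha, hlt⟩ := Nat.mem_rfind.1 ha
    obtain ⟨x, hx, hx0⟩ := (Part.mem_map_iff _).1 ha
    have hlt' : ∀ i ∈ Set.Iio a, ∀ᶠ k in l, ∃ y ∈ evalp (Os k) cf
        (Nat.pair n.unpair.1 (i + n.unpair.2)), decide (y = 0) = false := by
      intro i hi
      obtain ⟨y, hy, hy0⟩ := (Part.mem_map_iff _).1 (hlt hi)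
      filter_upwards [ih _ _ hy] with k hk
      exact ⟨y, hk, hy0⟩
    filter_upwards [ih _ _ hx, (eventually_all_finite (Set.finite_Iio a)).2 hlt'] with k h1 h2
    exact (Part.mem_map_iff _).2 ⟨a, Nat.mem_rfind.2 ⟨(Part.mem_map_iff _).2 ⟨x, h1, hx0⟩,
      fun {i} hi => (Part.mem_map_iff _).2 (h2 i hi)⟩, rfl⟩

theorem mem_evalp_mono {O O' : ℕ →. ℕ} (h : ∀ i v, v ∈ O i → v ∈ O' i) {c : OCode} {n v : ℕ}
    (hv : v ∈ evalp O c n) : v ∈ evalp O' c n := by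
  have := eventually_mem_evalp (l := (pure () : Filter Unit)) (Os := fun _ => O')
    (fun i v hv => Eventually.of_forall fun _ => h i v hv) c n v hv
  simpa using this

/-- The partial oracle given by a string. -/
def strOracle (l : Str) : ℕ →. ℕ := fun i => (l[i]? : Part ℕ)

/-- A plain code as an oracle code making no queries. -/
def ofCode : Code → OCode
  | .zero => .zero
  | .succ => .succ
  | .left => .left
  | .right => .right
  | .pair cf cg => .pair (ofCode cf) (ofCode cg)
  | .comp cf cg => .comp (ofCode cf) (ofCode cg)
  | .prec cf cg => .prec (ofCode cf) (ofCode cg)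
  | .rfind' cf => .rfind' (ofCode cf)

theorem evalo_ofCode (A : ℕ → ℕ) (c : Code) : evalo A (ofCode c) = c.eval := by
  induction c <;> simp [ofCode, evalo, Code.eval, *] <;> rfl

theorem evalo_comp_eq {Z : ℕ → ℕ} {f g : OCode} {n x : ℕ} {r : Part ℕ}
    (hg : evalo Z g n = Part.some x) (hf : evalo Z f x = r) : evalo Z (.comp f g) n = r := by
  change ((evalo Z g n).bind fun m => evalo Z f m) = r
  rw [hg, Part.bind_some, hf]

theorem evalo_pair_eq {Z : ℕ → ℕ} {f g : OCode} {n x y : ℕ}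
    (hf : evalo Z f n = Part.some x) (hg : evalo Z g n = Part.some y) :
    evalo Z (.pair f g) n = Part.some (Nat.pair x y) := by
  simp [evalo, hf, hg, Seq.seq]

theorem exists_oCode_of_primrec {α β : Type*} [Primcodable α] [Primcodable β] {f : α → β}
    (hf : Primrec f) :
    ∃ c : OCode, ∀ Z a, evalo Z c (Encodable.encode a) = Part.some (Encodable.encode (f a)) := by
  obtain ⟨c, hc⟩ := Code.exists_code.1 hf.to_comp
  refine ⟨ofCode c, fun Z a => ?_⟩
  rw [evalo_ofCode, hc]
  simp

theorem initSeg_succ (Z : ℕ → ℕ) (n : ℕ) : initSeg Z (n + 1) = initSeg Z n ++ [Z n] := by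
  simp [initSeg, List.range_succ]

theorem exists_oCode_initSeg :
    ∃ c : OCode, ∀ Z a n, evalo Z c (Nat.pair a n) =
      Part.some (Encodable.encode (initSeg Z n)) := by
  obtain ⟨c0, h0⟩ := exists_oCode_of_primrec (Primrec.const ([] : Str) : Primrec fun _ : ℕ => _)
  obtain ⟨c1, h1⟩ := exists_oCode_of_primrec (f := fun p : Str × ℕ => p.1 ++ [p.2])
    (Primrec.list_concat.comp Primrec.fst Primrec.snd)
  refine ⟨.prec c0 (.comp c1 (.pair (.comp .right .right)
    (.comp .oracle (.comp .left .right)))), fun Z a n => ?_⟩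
  have hstep : ∀ y, evalo Z (.comp c1 (.pair (.comp .right .right)
      (.comp .oracle (.comp .left .right))))
      (Nat.pair a (Nat.pair y (Encodable.encode (initSeg Z y)))) =
      Part.some (Encodable.encode (initSeg Z (y + 1))) := by
    intro y
    have := h1 Z (initSeg Z y, Z y)
    simp only [Encodable.encode_prod_val, Encodable.encode_nat] at this
    rw [initSeg_succ, ← this]
    exact evalo_comp_eq (evalo_pair_eq (by simp [evalo]) (by simp [evalo])) rfl
  rw [evalo]
  simp only [Nat.unpaired, Nat.unpair_pair]
  induction n with
  | zero => exact h0 Z a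
  | succ n ih =>
    rw [← hstep n]
    simp only [ih]
    exact Part.bind_some _ _

/-- Unbounded search for a witness of a primitive recursive relation that looks at a bounded part
of the oracle is uniformly computable from the oracle. -/
theorem exists_oCode_search {H : ℕ → ℕ → Str → Prop} {b : ℕ → ℕ → ℕ}
    (hH : PrimrecPred fun p : (ℕ × ℕ) × Str => H p.1.1 p.1.2 p.2) (hb : Primrec₂ b) :
    ∃ c : OCode, ∀ Z n v, H n v (initSeg Z (b n v)) → (∀ m < v, ¬ H n m (initSeg Z (b n m))) →
      evalo Z c n = Part.some v := by
  obtain ⟨ci, hi⟩ := exists_oCode_initSeg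
  obtain ⟨cb, hcb⟩ := exists_oCode_of_primrec hb
  obtain ⟨ch, hch⟩ := exists_oCode_of_primrec
    (Primrec.ite hH (Primrec.const 0) (Primrec.const 1))
  obtain ⟨cid, hid⟩ := exists_oCode_of_primrec (Primrec.id (α := ℕ))
  let body : OCode := .comp ch (.pair cid (.comp ci (.pair .zero cb)))
  have hbody : ∀ Z n m, evalo Z body (Nat.pair n m) =
      Part.some (if H n m (initSeg Z (b n m)) then 0 else 1) := by
    intro Z n m
    have h1 := hcb Z (n, m)
    have h2 := hch Z ((n, m), initSeg Z (b n m))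
    have h3 := hid Z (Nat.pair n m)
    simp only [Encodable.encode_prod_val, Encodable.encode_nat, id] at h1 h2 h3
    exact evalo_comp_eq (evalo_pair_eq h3 (evalo_comp_eq (evalo_pair_eq rfl h1) (hi _ _ _))) h2
  refine ⟨.comp (.rfind' body) (.pair cid .zero), fun Z n v hv hlt => ?_⟩
  have h3 := hid Z n
  simp only [Encodable.encode_nat, id] at h3
  refine evalo_comp_eq (evalo_pair_eq h3 rfl) ?_
  simp only [evalo, Nat.unpaired, Nat.unpair_pair, hbody, Nat.add_zero, Part.map_eq_map,
    Part.map_some]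
  apply Part.eq_some_iff.2
  refine (Part.mem_map_iff _).2 ⟨v, Nat.mem_rfind.2 ⟨?_, fun {m} hm => ?_⟩, rfl⟩
  · simp [hv]
  · simp [hlt m hm]

/-! ### The finite-oracle translation into plain codes -/

theorem exists_lookup_code :
    ∃ o : Code, ∀ (l : Str) (n : ℕ), o.eval (Nat.pair (Encodable.encode l) n) = strOracle l n := by
  obtain ⟨o, ho⟩ := Code.exists_code.1
    (Primrec.list_getElem? (α := ℕ)).to_comp.ofOption
  refine ⟨o, fun l n => ?_⟩
  rw [ho]
  simp [strOracle, Part.map_id']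

/-- A code that looks up an entry of a string. -/
noncomputable def lookupCode : Code := exists_lookup_code.choose

theorem eval_comp (f g : Code) (n : ℕ) :
    (Code.comp f g).eval n = (g.eval n).bind fun m => f.eval m := rfl

theorem eval_succ (n : ℕ) : Code.succ.eval n = Part.some (n + 1) := rfl

theorem eval_left (n : ℕ) : Code.left.eval n = Part.some n.unpair.1 := rfl

theorem eval_right (n : ℕ) : Code.right.eval n = Part.some n.unpair.2 := rfl

theorem eval_pair (f g : Code) (n : ℕ) :
    (Code.pair f g).eval n = (f.eval n).bind fun a => (g.eval n).map (Nat.pair a) := by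
  simp [Code.eval, Seq.seq]

/-- Rearrange `(l, (a, n))` to `((l, a), n)`. -/
def assocLeft : Code :=
  .pair (.pair .left (.comp .left .right)) (.comp .right .right)

/-- Rearrange `((l, a), n)` to `(l, (a, n))`. -/
def assocRight : Code :=
  .pair (.comp .left .left) (.pair (.comp .right .left) .right)

theorem eval_assocLeft (l a n : ℕ) :
    assocLeft.eval (Nat.pair l (Nat.pair a n)) = Part.some (Nat.pair (Nat.pair l a) n) := by
  simp [assocLeft, eval_comp, eval_pair, eval_left, eval_right]

theorem eval_assocRight (l a n : ℕ) :
    assocRight.eval (Nat.pair (Nat.pair l a) n) = Part.some (Nat.pair l (Nat.pair a n)) := by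
  simp [assocRight, eval_comp, eval_pair, eval_left, eval_right]

/-- Translate an oracle code into a plain code that receives a finite part of the oracle as the
first component of its input. -/
noncomputable def toCode : OCode → Code
  | .zero => .zero
  | .succ => .comp .succ .right
  | .left => .comp .left .right
  | .right => .comp .right .right
  | .oracle => lookupCode
  | .pair cf cg => .pair (toCode cf) (toCode cg)
  | .comp cf cg => .comp (toCode cf) (.pair .left (toCode cg))
  | .prec cf cg => .comp (.prec (toCode cf) (.comp (toCode cg) assocRight)) assocLeft
  | .rfind' cf => .comp (.rfind' (.comp (toCode cf) assocRight)) assocLeft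

theorem eval_toCode (l : Str) (c : OCode) :
    ∀ n, (toCode c).eval (Nat.pair (Encodable.encode l) n) = evalp (strOracle l) c n := by
  induction c with
  | zero => exact fun n => rfl
  | succ | left | right =>
    intro n
    simp [toCode, eval_comp, eval_succ, eval_left, eval_right, evalp]
  | oracle => exact exists_lookup_code.choose_spec l
  | pair cf cg ihf ihg => intro n; simp [toCode, Code.eval, evalp, ihf, ihg]
  | comp cf cg ihf ihg =>
    intro n
    change _ = (evalp _ cg n).bind fun m => evalp _ cf m
    simp [toCode, eval_comp, eval_pair, eval_left, ihg, ihf, Part.bind_map]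
  | prec cf cg ihf ihg =>
    intro n
    rw [← Nat.pair_unpair n]
    generalize n.unpair.1 = a
    generalize n.unpair.2 = m
    rw [toCode, eval_comp, eval_assocLeft, Part.bind_some, evalp]
    simp only [Nat.unpaired, Nat.unpair_pair]
    induction m with
    | zero => rw [Code.eval_prec_zero, ihf]; rfl
    | succ m ih =>
      rw [Code.eval_prec_succ, ih]
      simp only [eval_comp, eval_assocRight, Part.bind_some, ihg]
  | rfind' cf ih =>
    intro n
    rw [← Nat.pair_unpair n]
    generalize n.unpair.1 = a
    generalize n.unpair.2 = m
    rw [toCode, eval_comp, eval_assocLeft, Part.bind_some, evalp]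
    simp only [Code.eval.eq_8, Nat.unpaired, Nat.unpair_pair, eval_comp, eval_assocRight,
      Part.bind_some, ih]

/-- One step of the course-of-values recursion computing `toCode ∘ OCode.ofNat`. -/
noncomputable def toCodeStep (L : List Code) : Code :=
  let n := L.length
  let d := (n - 5).div2.div2
  let x := L.getD d.unpair.1 .zero
  let y := L.getD d.unpair.2 .zero
  let z := L.getD d .zero
  if n = 0 then .zero else if n = 1 then .comp .succ .right else
  if n = 2 then .comp .left .right else if n = 3 then .comp .right .right else
  if n = 4 then lookupCode else
  bif (n - 5).bodd then
    bif (n - 5).div2.bodd then .comp (.rfind' (.comp z assocRight)) assocLeft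
    else .comp (.prec x (.comp y assocRight)) assocLeft
  else
    bif (n - 5).div2.bodd then .comp x (.pair .left y)
    else .pair x y

theorem primrec_toCodeStep : Primrec toCodeStep := by
  have hn : Primrec (List.length : List Code → ℕ) := Primrec.list_length
  have hk : Primrec fun L : List Code => L.length - 5 :=
    Primrec.nat_sub.comp hn (Primrec.const 5)
  have hd := Primrec.nat_div2.comp (Primrec.nat_div2.comp hk)
  have hu := Primrec.unpair.comp hd
  have hx := (Primrec.list_getD Code.zero).comp Primrec.id (Primrec.fst.comp hu)
  have hy := (Primrec.list_getD Code.zero).comp Primrec.id (Primrec.snd.comp hu)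
  have hz := (Primrec.list_getD Code.zero).comp Primrec.id hd
  have hc {α : Type} [Primcodable α] {f g : α → Code} (hf : Primrec f) (hg : Primrec g) :
    Primrec fun a => Code.comp (f a) (g a) := Code.primrec₂_comp.comp hf hg
  have ha {α : Type} [Primcodable α] (c : Code) : Primrec fun _ : α => c := Primrec.const c
  have he (i : ℕ) : PrimrecPred fun L : List Code => L.length = i :=
    Primrec.eq.comp hn (Primrec.const i)
  exact Primrec.ite (he 0) (ha _) <| Primrec.ite (he 1) (ha _) <| Primrec.ite (he 2) (ha _) <|
    Primrec.ite (he 3) (ha _) <| Primrec.ite (he 4) (ha _) <|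
    Primrec.cond (Primrec.nat_bodd.comp hk)
      (Primrec.cond (Primrec.nat_bodd.comp (Primrec.nat_div2.comp hk))
        (hc (Code.primrec_rfind'.comp (hc hz (ha _))) (ha _))
        (hc (Code.primrec₂_prec.comp hx (hc hy (ha _))) (ha _)))
      (Primrec.cond (Primrec.nat_bodd.comp (Primrec.nat_div2.comp hk))
        (hc hx (Code.primrec₂_pair.comp (ha _) hy))
        (Code.primrec₂_pair.comp hx hy))

theorem primrec_toCode_ofNat : Primrec fun e => toCode (OCode.ofNat e) := by
  have h := Primrec.nat_strong_rec (α := Unit) (fun _ e => toCode (OCode.ofNat e))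
    (g := fun _ L => some (toCodeStep L))
    (Primrec.option_some.comp (primrec_toCodeStep.comp Primrec.snd)) fun _ n => ?_
  · exact h.comp (Primrec.const ()) Primrec.id
  · match n with
    | 0 | 1 | 2 | 3 | 4 => simp [toCodeStep, OCode.ofNat, toCode]
    | n + 5 =>
      have hd : n.div2.div2 < n + 5 := by simp only [Nat.div2_val]; omega
      have h1 := (Nat.unpair_left_le n.div2.div2).trans_lt hd
      have h2 := (Nat.unpair_right_le n.div2.div2).trans_lt hd
      have hget : ∀ i < n + 5, ((List.range (n + 5)).map fun e => toCode (OCode.ofNat e)).getD i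
          .zero = toCode (OCode.ofNat i) := by
        intro i hi
        simp [List.getD, hi]
      rw [OCode.ofNat]
      simp only [toCodeStep, List.length_map, List.length_range, Nat.add_sub_cancel,
        hget _ hd, hget _ h1, hget _ h2]
      cases n.bodd <;> cases n.div2.bodd <;> simp [toCode]

/-! ### Approximating the jump -/

theorem length_initSeg (X : ℕ → ℕ) (n : ℕ) : (initSeg X n).length = n := by simp [initSeg]

theorem getElem?_initSeg (X : ℕ → ℕ) {n i : ℕ} (h : i < n) : (initSeg X n)[i]? = some (X i) := by
  simp [initSeg, h]

theorem getD_initSeg (X : ℕ → ℕ) {n i : ℕ} (h : i < n) (d : ℕ) : (initSeg X n).getD i d = X i := by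
  simp [List.getD, getElem?_initSeg X h]

theorem take_initSeg (X : ℕ → ℕ) {k n : ℕ} (h : k ≤ n) : (initSeg X n).take k = initSeg X k := by
  simp [initSeg, ← List.map_take, List.take_range, h]

theorem initSeg_congr {X Y : ℕ → ℕ} {n : ℕ} (h : ∀ i < n, X i = Y i) :
    initSeg X n = initSeg Y n :=
  List.map_congr_left fun i hi => h i (List.mem_range.1 hi)

/-- The approximation to the jump of `A` computed from a finite initial segment `l` of `A`. -/
noncomputable def stageJump (l : Str) : Str :=
  (List.range l.length).map fun e =>
    if ∃ k < l.length, ∃ x, x ∈ Code.evaln l.length (toCode (OCode.ofNat e))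
      (Nat.pair (Encodable.encode (l.take k)) e) then 1 else 0

theorem primrecPred_exists_lt {α : Type*} [Primcodable α] {p : α → ℕ → Prop} {b : α → ℕ}
    (hp : PrimrecRel p) (hb : Primrec b) : PrimrecPred fun a => ∃ k < b a, p a k :=
  (hp.swap.exists_mem_list.comp (Primrec.list_range.comp hb) Primrec.id).of_eq fun a => by simp

theorem primrecPred_forall_lt {α : Type*} [Primcodable α] {p : α → ℕ → Prop} {b : α → ℕ}
    (hp : PrimrecRel p) (hb : Primrec b) : PrimrecPred fun a => ∀ k < b a, p a k :=
  (hp.swap.forall_mem_list.comp (Primrec.list_range.comp hb) Primrec.id).of_eq fun a => by simp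

theorem primrec_stageJump : Primrec stageJump := by
  refine Primrec.list_map (Primrec.list_range.comp Primrec.list_length) (Primrec.ite ?_
    (Primrec.const 1) (Primrec.const 0))
  refine primrecPred_exists_lt (α := Str × ℕ) (b := fun a => a.1.length)
    (p := fun a k => ∃ x, x ∈ Code.evaln a.1.length (toCode (OCode.ofNat a.2))
      (Nat.pair (Encodable.encode (a.1.take k)) a.2)) ?_ (Primrec.list_length.comp Primrec.fst)
  have h : Primrec fun q : (Str × ℕ) × ℕ => Code.evaln q.1.1.length (toCode (OCode.ofNat q.1.2))
      (Nat.pair (Encodable.encode (q.1.1.take q.2)) q.1.2) :=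
    Code.primrec_evaln.comp <| ((Primrec.list_length.comp (Primrec.fst.comp Primrec.fst)).pair
      (primrec_toCode_ofNat.comp (Primrec.snd.comp Primrec.fst))).pair
      (Primrec₂.natPair.comp (Primrec.encode.comp (Primrec.list_take.comp Primrec.snd
        (Primrec.fst.comp Primrec.fst))) (Primrec.snd.comp Primrec.fst))
  exact (Primrec.eq.comp (Primrec.option_isSome.comp h) (Primrec.const true)).of_eq fun q => by
    simp [Option.isSome_iff_exists]

theorem mem_evalo_of_strOracle {A : ℕ → ℕ} {k : ℕ} {c : OCode} {n v : ℕ}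
    (h : v ∈ evalp (strOracle (initSeg A k)) c n) : v ∈ evalo A c n := by
  rw [← evalp_total]
  refine mem_evalp_mono (fun i w hw => ?_) h
  simp only [strOracle, initSeg, List.getElem?_map, Part.mem_coe, Option.mem_def,
    Option.map_eq_some_iff, List.getElem?_eq_some_iff] at hw
  obtain ⟨a, ⟨ha, rfl⟩, rfl⟩ := hw
  simp

theorem eventually_mem_evalp_of_evalo {B : ℕ → ℕ} {Bs : ℕ → Str}
    (hB : ∀ e, ∀ᶠ t in atTop, (Bs t)[e]? = some (B e)) {c : OCode} {n v : ℕ}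
    (h : v ∈ evalo B c n) : ∀ᶠ t in atTop, v ∈ evalp (strOracle (Bs t)) c n := by
  rw [← evalp_total] at h
  refine eventually_mem_evalp (fun i w hw => ?_) c n v h
  filter_upwards [hB i] with t ht
  rw [strOracle, ht]
  simpa using hw

theorem eventually_stageJump (A : ℕ → ℕ) (e : ℕ) :
    ∀ᶠ t in atTop, (stageJump (initSeg A t))[e]? = some (jump A e) := by
  by_cases hd : (evalo A (OCode.ofNat e) e).Dom
  · obtain ⟨v, hv⟩ := Part.dom_iff_mem.1 hd
    obtain ⟨k, hk⟩ := (eventually_mem_evalp_of_evalo (Bs := initSeg A)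
      (fun i => (eventually_gt_atTop i).mono fun t ht => getElem?_initSeg A ht) hv).exists
    rw [← eval_toCode] at hk
    obtain ⟨s, hs⟩ := Code.evaln_complete.1 hk
    filter_upwards [eventually_gt_atTop e, eventually_gt_atTop k, eventually_ge_atTop s]
      with t he hkt hst
    have : ∃ k < t, ∃ x, x ∈ Code.evaln t (toCode (OCode.ofNat e))
        (Nat.pair (Encodable.encode ((initSeg A t).take k)) e) :=
      ⟨k, hkt, v, Code.evaln_mono hst (by rwa [take_initSeg A hkt.le])⟩
    rw [stageJump, jump, if_pos hd]
    simp only [length_initSeg, List.getElem?_map, List.getElem?_range he, Option.map_some]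
    rw [if_pos this]
  · filter_upwards [eventually_gt_atTop e] with t he
    rw [stageJump, jump, if_neg hd]
    simp only [length_initSeg, List.getElem?_map, List.getElem?_range he, Option.map_some]
    rw [if_neg]
    rintro ⟨k, hk, x, hx⟩
    rw [take_initSeg A hk.le] at hx
    have := Code.evaln_sound hx
    rw [eval_toCode] at this
    exact hd (Part.dom_iff_mem.2 ⟨x, mem_evalo_of_strOracle this⟩)

/-- `m = ⟨t, u⟩` with `t ≥ s` witnesses that the computation `c` on input `σ`, run for `u` steps
with the approximation to the jump computed from the string `l`, has output `1`. -/
def JumpWitness (c : OCode) (s m : ℕ) (σ l : Str) : Prop :=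
  s ≤ m.unpair.1 ∧ 1 ∈ Code.evaln m.unpair.2 (toCode c)
    (Nat.pair (Encodable.encode (stageJump l)) (Encodable.encode σ))

theorem primrecPred_jumpWitness (c : OCode) :
    PrimrecPred fun p : (ℕ × ℕ) × Str × Str => JumpWitness c p.1.1 p.1.2 p.2.1 p.2.2 := by
  have hm : Primrec fun p : (ℕ × ℕ) × Str × Str => p.1.2.unpair :=
    Primrec.unpair.comp (Primrec.snd.comp Primrec.fst)
  refine (Primrec.nat_le.comp (Primrec.fst.comp Primrec.fst) (Primrec.fst.comp hm)).and ?_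
  refine (Primrec.eq.comp (Code.primrec_evaln.comp (((Primrec.snd.comp hm).pair
    (Primrec.const (toCode c))).pair (Primrec₂.natPair.comp
      (Primrec.encode.comp (primrec_stageJump.comp (Primrec.snd.comp Primrec.snd)))
      (Primrec.encode.comp (Primrec.fst.comp Primrec.snd))))) (Primrec.const (some 1)))

theorem mem_iff_forall_exists_jumpWitness {A : ℕ → ℕ} {T : Set Str} {c : OCode}
    (hc : ∀ σ : Str, evalo (jump A) c (Encodable.encode σ) = Part.some (chi T σ)) (σ : Str) :
    σ ∈ T ↔ ∀ s, ∃ m : ℕ, JumpWitness c s m σ (initSeg A m.unpair.1) := by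
  have hlim : ∀ᶠ t in atTop, chi T σ ∈ (toCode c).eval
      (Nat.pair (Encodable.encode (stageJump (initSeg A t))) (Encodable.encode σ)) := by
    simp only [eval_toCode]
    exact eventually_mem_evalp_of_evalo (eventually_stageJump A) (by simp [hc σ])
  constructor
  · intro hσ s
    obtain ⟨t, ht, hst⟩ := (hlim.and (eventually_ge_atTop s)).exists
    obtain ⟨u, hu⟩ := Code.evaln_complete.1 ht
    refine ⟨Nat.pair t u, ?_⟩
    simp only [JumpWitness, Nat.unpair_pair]
    rw [chi, if_pos hσ] at hu
    exact ⟨hst, hu⟩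
  · intro h
    obtain ⟨s, hs⟩ := eventually_atTop.1 hlim
    obtain ⟨m, hm, hu⟩ := h s
    have := Part.mem_unique (hs _ hm) (Code.evaln_sound hu)
    by_contra hσ
    simp [chi, hσ] at this

/-! ### Relativized `Π⁰₂` sets -/

/-- `v` is the least number `m` such that `V j m σ (A↾m₁)`, where `m = ⟨m₁, m₂⟩`. -/
def IsLeastWitness (V : ℕ → ℕ → Str → Str → Prop) (A : ℕ → ℕ) (j v : ℕ) (σ : Str) : Prop :=
  V j v σ (initSeg A v.unpair.1) ∧ ∀ m < v, ¬ V j m σ (initSeg A m.unpair.1)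

theorem IsLeastWitness.unique {V : ℕ → ℕ → Str → Str → Prop} {A : ℕ → ℕ} {j v w : ℕ} {σ : Str}
    (hv : IsLeastWitness V A j v σ) (hw : IsLeastWitness V A j w σ) : v = w := by
  by_contra h
  rcases lt_or_gt_of_ne h with h | h
  exacts [hw.2 _ h hv.1, hv.2 _ h hw.1]

/-- The least witness if there is one, and `0` otherwise. -/
noncomputable def leastWitness (V : ℕ → ℕ → Str → Str → Prop) (A : ℕ → ℕ) (j : ℕ) (σ : Str) : ℕ :=
  if h : ∃ m : ℕ, V j m σ (initSeg A m.unpair.1) then Nat.find h else 0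

theorem isLeastWitness_leastWitness {V : ℕ → ℕ → Str → Str → Prop} {A : ℕ → ℕ} {j : ℕ} {σ : Str}
    (h : ∃ m : ℕ, V j m σ (initSeg A m.unpair.1)) :
    IsLeastWitness V A j (leastWitness V A j σ) σ := by
  rw [leastWitness, dif_pos h]
  exact ⟨Nat.find_spec h, fun m hm => Nat.find_min h hm⟩

/-- Join `X` with the function choosing least witnesses for `X`. -/
noncomputable def joinWitness (V : ℕ → ℕ → Str → Str → Prop) (A X : ℕ → ℕ) : ℕ → ℕ :=
  oplus X fun j => leastWitness V A j (initSeg X j.unpair.1)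

theorem oplus_even (X Y : ℕ → ℕ) (i : ℕ) : oplus X Y (2 * i) = X i := by
  simp [oplus]

theorem oplus_odd (X Y : ℕ → ℕ) (i : ℕ) : oplus X Y (2 * i + 1) = Y i := by
  have h1 : (2 * i + 1) % 2 = 1 := by omega
  have h2 : (2 * i + 1) / 2 = i := by omega
  simp [oplus, h1, h2]

theorem continuous_comp_initSeg (g : Str → ℕ) (k : ℕ) :
    Continuous fun X : ℕ → ℕ => g (initSeg X k) := by
  have : (fun X : ℕ → ℕ => g (initSeg X k)) =
      (fun p : Fin k → ℕ => g (List.ofFn p)) ∘ fun X i => X i := by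
    funext X
    have : initSeg X k = List.ofFn fun i : Fin k => X i :=
      List.ext_getElem (by simp [initSeg]) (by simp [initSeg])
    simp [this]
  rw [this]
  exact continuous_of_discreteTopology.comp (by fun_prop)

theorem continuous_joinWitness (V : ℕ → ℕ → Str → Str → Prop) (A : ℕ → ℕ) :
    Continuous (joinWitness V A) := by
  refine continuous_pi fun n => ?_
  obtain ⟨i, rfl | rfl⟩ := n.even_or_odd'
  · simp only [joinWitness, oplus_even]
    exact continuous_apply i
  · simp only [joinWitness, oplus_odd]
    exact continuous_comp_initSeg _ _

/-- The tree of strings that look like initial segments of `joinWitness V A X` for some `X`. -/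
def witnessTree (V : ℕ → ℕ → Str → Str → Prop) (A : ℕ → ℕ) : Set Str :=
  {τ | ∀ j < τ.length, 2 * j + 1 < τ.length → IsLeastWitness V A j (τ.getD (2 * j + 1) 0)
    (initSeg (fun i => τ.getD (2 * i) 0) j.unpair.1)}

theorem isTree_witnessTree (V : ℕ → ℕ → Str → Str → Prop) (A : ℕ → ℕ) :
    IsTree (witnessTree V A) := by
  intro σ τ hστ hτ j hj hj'
  have hget : ∀ i < σ.length, σ.getD i 0 = τ.getD i 0 := by
    obtain ⟨ρ, rfl⟩ := hστ
    intro i hi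
    simp [List.getD, List.getElem?_append_left hi]
  have := hτ j (hj.trans_le hστ.length_le) (hj'.trans_le hστ.length_le)
  rw [← hget _ hj'] at this
  rwa [initSeg_congr (Y := fun i => τ.getD (2 * i) 0)]
  intro i hi
  have := Nat.unpair_left_le j
  exact hget _ (by omega)

theorem mem_paths_witnessTree {V : ℕ → ℕ → Str → Str → Prop} {A Y : ℕ → ℕ} :
    Y ∈ paths (witnessTree V A) ↔ ∀ j, IsLeastWitness V A j (Y (2 * j + 1))
      (initSeg (fun i => Y (2 * i)) j.unpair.1) := by
  have key : ∀ n j, 2 * j + 1 < n →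
      ((initSeg Y n).getD (2 * j + 1) 0 = Y (2 * j + 1) ∧
      initSeg (fun i => (initSeg Y n).getD (2 * i) 0) j.unpair.1 =
        initSeg (fun i => Y (2 * i)) j.unpair.1) := by
    intro n j hj
    refine ⟨getD_initSeg Y hj 0, initSeg_congr fun i hi => getD_initSeg Y ?_ 0⟩
    have := Nat.unpair_left_le j
    omega
  constructor
  · intro h j
    have := h (2 * j + 2) j (by rw [length_initSeg]; omega) (by rw [length_initSeg]; omega)
    rwa [(key _ j (by omega)).1, (key _ j (by omega)).2] at this
  · intro h n j _ hj
    rw [length_initSeg] at hj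
    rw [(key n j hj).1, (key n j hj).2]
    exact h j

theorem paths_witnessTree (V : ℕ → ℕ → Str → Str → Prop) (A : ℕ → ℕ) :
    paths (witnessTree V A) = joinWitness V A ''
      {X | ∀ j : ℕ, ∃ m : ℕ, V j m (initSeg X j.unpair.1) (initSeg A m.unpair.1)} := by
  ext Y
  rw [mem_paths_witnessTree]
  constructor
  · intro h
    refine ⟨fun i => Y (2 * i), fun j => ⟨_, (h j).1⟩, ?_⟩
    funext n
    obtain ⟨i, rfl | rfl⟩ := n.even_or_odd'
    · rw [joinWitness, oplus_even]
    · rw [joinWitness, oplus_odd]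
      exact (isLeastWitness_leastWitness ⟨_, (h i).1⟩).unique (h i)
  · rintro ⟨X, hX, rfl⟩ j
    simp only [joinWitness, oplus_even, oplus_odd]
    exact isLeastWitness_leastWitness (hX j)

theorem lt_encode_of_mem {v : ℕ} {l : Str} (h : v ∈ l) : v < Encodable.encode l := by
  induction l with
  | nil => simp at h
  | cons a l ih =>
    rw [Encodable.encode_list_cons, Encodable.encode_nat]
    rcases List.mem_cons.1 h with rfl | h
    · exact Nat.lt_succ_of_le (Nat.left_le_pair _ _)
    · exact ((ih h).trans_le (Nat.right_le_pair _ _)).trans (Nat.lt_succ_self _)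

theorem setRecIn_witnessTree {V : ℕ → ℕ → Str → Str → Prop}
    (hV : PrimrecPred fun p : (ℕ × ℕ) × Str × Str => V p.1.1 p.1.2 p.2.1 p.2.2) (A : ℕ → ℕ) :
    SetRecIn A (witnessTree V A) := by
  let good : Str → Str → Prop := fun τ l => ∀ j < τ.length, 2 * j + 1 < τ.length →
    V j (τ.getD (2 * j + 1) 0) (initSeg (fun i => τ.getD (2 * i) 0) j.unpair.1)
      (l.take (τ.getD (2 * j + 1) 0).unpair.1) ∧
    ∀ m < τ.getD (2 * j + 1) 0, ¬ V j m (initSeg (fun i => τ.getD (2 * i) 0) j.unpair.1)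
      (l.take m.unpair.1)
  have hgood : PrimrecPred fun p : Str × Str => good p.1 p.2 := by
    have hodd {α : Type} [Primcodable α] {f : α → ℕ} {g : α → Str} (hf : Primrec f)
        (hg : Primrec g) : Primrec fun a => (g a).getD (2 * f a + 1) 0 :=
      (Primrec.list_getD 0).comp hg (Primrec.succ.comp
        (Primrec.nat_mul.comp (Primrec.const 2) hf))
    have hevens {α : Type} [Primcodable α] {f : α → ℕ} {g : α → Str} (hf : Primrec f)
        (hg : Primrec g) : Primrec fun a => initSeg (fun i => (g a).getD (2 * i) 0) (f a) :=
      Primrec.list_map (Primrec.list_range.comp hf) ((Primrec.list_getD 0).comp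
        (hg.comp Primrec.fst) (Primrec.nat_mul.comp (Primrec.const 2) Primrec.snd))
    have hfst {α : Type} [Primcodable α] {f : α → ℕ} (hf : Primrec f) :
        Primrec fun a => (f a).unpair.1 := Primrec.fst.comp (Primrec.unpair.comp hf)
    have hτ := Primrec.fst.comp (Primrec.fst (α := Str × Str) (β := ℕ))
    have hl := Primrec.snd.comp (Primrec.fst (α := Str × Str) (β := ℕ))
    have hj := Primrec.snd (α := Str × Str) (β := ℕ)
    have hlt : PrimrecPred fun q : (Str × Str) × ℕ => 2 * q.2 + 1 < q.1.1.length :=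
      Primrec.nat_lt.comp (Primrec.succ.comp (Primrec.nat_mul.comp (Primrec.const 2) hj))
        (Primrec.list_length.comp hτ)
    have h1 : PrimrecPred fun q : (Str × Str) × ℕ =>
        V q.2 (q.1.1.getD (2 * q.2 + 1) 0)
          (initSeg (fun i => q.1.1.getD (2 * i) 0) q.2.unpair.1)
          (q.1.2.take (q.1.1.getD (2 * q.2 + 1) 0).unpair.1) :=
      hV.comp ((hj.pair (hodd hj hτ)).pair ((hevens (hfst hj) hτ).pair
        (Primrec.list_take.comp (hfst (hodd hj hτ)) hl)))
    have h2 : PrimrecPred fun q : (Str × Str) × ℕ => ∀ m < q.1.1.getD (2 * q.2 + 1) 0,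
        ¬ V q.2 m (initSeg (fun i => q.1.1.getD (2 * i) 0) q.2.unpair.1)
          (q.1.2.take m.unpair.1) := by
      refine primrecPred_forall_lt (p := fun (q : (Str × Str) × ℕ) m => ¬ V q.2 m
        (initSeg (fun i => q.1.1.getD (2 * i) 0) q.2.unpair.1) (q.1.2.take m.unpair.1))
        ?_ (hodd hj hτ)
      have hfst' := Primrec.fst (α := (Str × Str) × ℕ) (β := ℕ)
      have hm := Primrec.snd (α := (Str × Str) × ℕ) (β := ℕ)
      exact (hV.comp (((hj.comp hfst').pair hm).pair
        ((hevens (hfst (hj.comp hfst')) (hτ.comp hfst')).pair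
          (Primrec.list_take.comp (hfst hm) (hl.comp hfst'))))).not
    refine primrecPred_forall_lt (p := fun (q : Str × Str) j => 2 * j + 1 < q.1.length → _) ?_
      (Primrec.list_length.comp Primrec.fst)
    exact (hlt.not.or (h1.and h2)).of_eq fun q => imp_iff_not_or.symm
  obtain ⟨c, hc⟩ := exists_oCode_search
    (H := fun n m l => m = if good (Denumerable.ofNat Str n) l then 1 else 0) (b := fun n _ => n)
    (Primrec.eq.comp (Primrec.snd.comp Primrec.fst) (Primrec.ite (hgood.comp
      (((Primrec.ofNat Str).comp (Primrec.fst.comp Primrec.fst)).pair Primrec.snd))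
      (Primrec.const 1) (Primrec.const 0))) Primrec.fst
  have hiff : ∀ τ : Str, good τ (initSeg A (Encodable.encode τ)) ↔ τ ∈ witnessTree V A := by
    intro τ
    refine forall₃_congr fun j _ hj => ?_
    have hv : τ.getD (2 * j + 1) 0 < Encodable.encode τ := by
      rw [List.getD_eq_getElem _ _ hj]
      exact lt_encode_of_mem (List.getElem_mem hj)
    have htake : ∀ m ≤ τ.getD (2 * j + 1) 0, (initSeg A (Encodable.encode τ)).take m.unpair.1 =
        initSeg A m.unpair.1 := fun m hm =>
      take_initSeg A ((Nat.unpair_left_le m).trans (hm.trans hv.le))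
    refine and_congr (by rw [htake _ le_rfl]) (forall₂_congr fun m hm => by rw [htake m hm.le])
  refine ⟨c, fun σ => hc A _ _ ?_ fun m hm => ?_⟩
  · simp only [Denumerable.ofNat_encode, hiff, chi]
  · simp only [Denumerable.ofNat_encode, hiff]
    exact hm.ne

theorem unifEquivOn_joinWitness {V : ℕ → ℕ → Str → Str → Prop}
    (hV : PrimrecPred fun p : (ℕ × ℕ) × Str × Str => V p.1.1 p.1.2 p.2.1 p.2.2) (A : ℕ → ℕ) :
    UnifEquivOn {X | ∀ j : ℕ, ∃ m : ℕ, V j m (initSeg X j.unpair.1) (initSeg A m.unpair.1)}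
      (fun X => oplus X A) (fun X => oplus (joinWitness V A X) A) := by
  have hsegm {α : Type} [Primcodable α] {f : α → ℕ} {g : α → Str} (hf : Primrec f)
      (hg : Primrec g) (r : ℕ) :
      Primrec fun a => initSeg (fun i => (g a).getD (2 * i + r) 0) (f a) :=
    Primrec.list_map (Primrec.list_range.comp hf) ((Primrec.list_getD 0).comp
      (hg.comp Primrec.fst) (Primrec.nat_add.comp
        (Primrec.nat_mul.comp (Primrec.const 2) Primrec.snd) (Primrec.const r)))
  have hfst {α : Type} [Primcodable α] {f : α → ℕ} (hf : Primrec f) :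
      Primrec fun a => (f a).unpair.1 := Primrec.fst.comp (Primrec.unpair.comp hf)
  have hn : Primrec fun p : (ℕ × ℕ) × Str => p.1.1 := Primrec.fst.comp Primrec.fst
  have hm : Primrec fun p : (ℕ × ℕ) × Str => p.1.2 := Primrec.snd.comp Primrec.fst
  have hl : Primrec fun p : (ℕ × ℕ) × Str => p.2 := Primrec.snd
  have hmod (k r : ℕ) : PrimrecPred fun p : (ℕ × ℕ) × Str => p.1.1 % k = r :=
    Primrec.eq.comp (Primrec.nat_mod.comp hn (Primrec.const k)) (Primrec.const r)
  have hget {f : (ℕ × ℕ) × Str → ℕ} (hf : Primrec f) :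
      PrimrecPred fun p : (ℕ × ℕ) × Str => p.1.2 = p.2.getD (f p) 0 :=
    Primrec.eq.comp hm ((Primrec.list_getD 0).comp hl hf)
  have hj : Primrec fun p : (ℕ × ℕ) × Str => p.1.1 / 4 :=
    Primrec.nat_div.comp hn (Primrec.const 4)
  obtain ⟨c, hc⟩ := exists_oCode_search
    (H := fun n m l => (n % 2 = 1 ∧ m = l.getD n 0) ∨ (n % 4 = 0 ∧ m = l.getD (n / 2) 0) ∨
      (n % 4 = 2 ∧ V (n / 4) m (initSeg (fun i => l.getD (2 * i + 0) 0) (n / 4).unpair.1)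
        (initSeg (fun i => l.getD (2 * i + 1) 0) m.unpair.1)))
    (b := fun n m => 2 * n + 2 * m + 2)
    (((hmod 2 1).and (hget hn)).or <| ((hmod 4 0).and
      (hget (Primrec.nat_div.comp hn (Primrec.const 2)))).or <| (hmod 4 2).and <|
      hV.comp ((hj.pair hm).pair ((hsegm (hfst hj) hl 0).pair (hsegm (hfst hm) hl 1))))
    (Primrec.nat_add.comp (Primrec.nat_add.comp (Primrec.nat_mul.comp (Primrec.const 2)
      Primrec.fst) (Primrec.nat_mul.comp (Primrec.const 2) Primrec.snd)) (Primrec.const 2))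
  obtain ⟨d, hd⟩ := exists_oCode_search
    (H := fun n m l => (n % 2 = 1 ∧ m = l.getD n 0) ∨ (n % 2 = 0 ∧ m = l.getD (2 * n) 0))
    (b := fun n _ => 2 * n + 1)
    (((hmod 2 1).and (hget hn)).or <| (hmod 2 0).and
      (hget (Primrec.nat_mul.comp (Primrec.const 2) hn)))
    (Primrec.succ.comp (Primrec.nat_mul.comp (Primrec.const 2) Primrec.fst))
  refine ⟨d, c, fun X hX => And.symm ⟨fun n => ?_, fun n => ?_⟩⟩
  · have hZ : ∀ m i, i < 2 * n + 2 * m + 2 →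
        (initSeg (oplus X A) (2 * n + 2 * m + 2)).getD i 0 = oplus X A i :=
      fun m i hi => getD_initSeg _ hi 0
    have hXseg : ∀ j m, j ≤ n → initSeg (fun i => (initSeg (oplus X A)
        (2 * n + 2 * m + 2)).getD (2 * i + 0) 0) j.unpair.1 = initSeg X j.unpair.1 := by
      refine fun j m hj => initSeg_congr fun i hi => ?_
      have := Nat.unpair_left_le j
      rw [hZ _ _ (by omega), Nat.add_zero, oplus_even]
    have hAseg : ∀ m : ℕ, initSeg (fun i => (initSeg (oplus X A)
        (2 * n + 2 * m + 2)).getD (2 * i + 1) 0) m.unpair.1 = initSeg A m.unpair.1 := by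
      refine fun m => initSeg_congr fun i hi => ?_
      have := Nat.unpair_left_le m
      rw [hZ _ _ (by omega), oplus_odd]
    obtain ⟨i, rfl | rfl⟩ := n.even_or_odd'
    · obtain ⟨j, rfl | rfl⟩ := i.even_or_odd'
      · have e2 : 2 * (2 * j) % 4 = 0 := by omega
        have e3 : 2 * (2 * j) / 2 = 2 * j := by omega
        simp only [joinWitness, oplus_even]
        refine hc _ _ _ (Or.inr (Or.inl ⟨e2, ?_⟩)) fun m hm => ?_
        · rw [e3, hZ _ _ (by omega), oplus_even]
        · rw [e3, hZ _ (2 * j) (by omega), oplus_even]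
          omega
      · have e1 : 2 * (2 * j + 1) % 2 ≠ 1 := by omega
        have e2 : 2 * (2 * j + 1) % 4 = 2 := by omega
        have e3 : 2 * (2 * j + 1) / 4 = j := by omega
        simp only [joinWitness, oplus_even, oplus_odd]
        have hleast := isLeastWitness_leastWitness (hX j)
        refine hc _ _ _ (Or.inr (Or.inr ⟨e2, ?_⟩)) fun m hm => ?_
        · rw [e3, hXseg j _ (by omega), hAseg]
          exact hleast.1
        · rw [e3, hXseg j _ (by omega), hAseg]
          rintro (h | h | h)
          exacts [e1 h.1, by omega, hleast.2 m hm h.2]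
    · simp only [oplus_odd]
      have e1 : (2 * i + 1) % 2 = 1 := by omega
      refine hc _ _ _ (Or.inl ⟨e1, ?_⟩) fun m hm => ?_
      · rw [hZ _ _ (by omega), oplus_odd]
      · rw [hZ _ _ (by omega), oplus_odd]
        omega
  · have hZ : ∀ i, i < 2 * n + 1 → (initSeg (oplus (joinWitness V A X) A)
        (2 * n + 1)).getD i 0 = oplus (joinWitness V A X) A i :=
      fun i hi => getD_initSeg _ hi 0
    obtain ⟨i, rfl | rfl⟩ := n.even_or_odd'
    · have hval := hZ (2 * (2 * i)) (by omega)
      rw [oplus_even, joinWitness, oplus_even, ← joinWitness] at hval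
      simp only [oplus_even]
      refine hd _ _ _ (Or.inr ⟨by omega, hval.symm⟩) fun m hm => ?_
      rw [hval]
      omega
    · have hval := hZ (2 * i + 1) (by omega)
      rw [oplus_odd] at hval
      simp only [oplus_odd]
      refine hd _ _ _ (Or.inl ⟨by omega, hval.symm⟩) fun m hm => ?_
      rw [hval]
      omega

theorem homeoOn_joinWitness (V : ℕ → ℕ → Str → Str → Prop) (A : ℕ → ℕ) (P : Set (ℕ → ℕ)) :
    HomeoOn (joinWitness V A) P (joinWitness V A '' P) := by
  have hinv : ∀ X, (fun i => joinWitness V A X (2 * i)) = X := fun X => by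
    funext i
    rw [joinWitness, oplus_even]
  refine ⟨⟨Set.mapsTo_image _ _, fun X _ Y _ h => ?_, Set.surjOn_image _ _⟩,
    (continuous_joinWitness V A).continuousOn, fun Y i => Y (2 * i), ⟨fun X _ => hinv X, ?_⟩, ?_⟩
  · rw [← hinv X, h, hinv Y]
  · rintro _ ⟨X, -, rfl⟩
    exact congrArg _ (hinv X)
  · exact (continuous_pi fun i => continuous_apply (2 * i)).continuousOn

/-- **Lemma.**  Given a `Π^{0,A'}_1` set `P` there are a `Π^{0,A}_1` set `Q` and a
homeomorphism `F : P → Q` such that `X ⊕ A ≡_T F(X) ⊕ A` uniformly for all `X ∈ P`. -/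
theorem pi01_jump_to_base_with_join_equiv (A : ℕ → ℕ) (P : Set (ℕ → ℕ))
    (hP : IsPi01In (jump A) P) :
    ∃ (Q : Set (ℕ → ℕ)) (F : (ℕ → ℕ) → (ℕ → ℕ)), IsPi01In A Q ∧ HomeoOn F P Q ∧
      UnifEquivOn P (fun X => oplus X A) (fun X => oplus (F X) A) := by
  obtain ⟨T, -, ⟨c, hc⟩, rfl⟩ := hP
  let V : ℕ → ℕ → Str → Str → Prop := fun j m σ l => JumpWitness c j.unpair.2 m σ l
  have hV : PrimrecPred fun p : (ℕ × ℕ) × Str × Str => V p.1.1 p.1.2 p.2.1 p.2.2 :=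
    (primrecPred_jumpWitness c).comp (((Primrec.snd.comp (Primrec.unpair.comp
      (Primrec.fst.comp Primrec.fst))).pair (Primrec.snd.comp Primrec.fst)).pair Primrec.snd)
  have hP : paths T =
      {X | ∀ j : ℕ, ∃ m : ℕ, V j m (initSeg X j.unpair.1) (initSeg A m.unpair.1)} := by
    ext X
    simp only [paths, Set.mem_ofPred_eq, mem_iff_forall_exists_jumpWitness hc]
    refine ⟨fun h j => h _ _, fun h n s => ?_⟩
    simpa [V] using h (Nat.pair n s)
  rw [hP]
  exact ⟨_, joinWitness V A, ⟨witnessTree V A, isTree_witnessTree V A,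
    setRecIn_witnessTree hV A, (paths_witnessTree V A).symm⟩, homeoOn_joinWitness V A _,
    unifEquivOn_joinWitness hV A⟩

end Harrington
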